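/- arXiv:2502.00185 — 2 statements merged into one kernel-verified Lean document; each statement's English description precedes it below -/
import Mathlib

section
/- Let ι be a finite type and let f : Finset ι → ℝ be a set function with f(∅) = 0 that is monotone (for all A ⊆ B, f(A) ≤ f(B)) and submodular (for all A ⊆ B and x ∉ B, f(A ∪ {x}) − f(A) ≥ f(B ∪ {x}) − f(B)). Let k ≥ 1 and let G₀ = ∅, G₁, …, G_k be the greedy sequence, where G_{i+1} = G_i ∪ {x_i} and x_i ∉ G_i maximizes f(G_i ∪ {x}) over all x ∉ G_i. Then f(G_k) ≥ (1 − (1 − 1/k)^k) · max { f(S) : S ⊆ ι, |S| = k }. -/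
/-- For a submodular function, if every single insertion into `A` gains at most `d ≥ 0`, then
adjoining a set `T` to `A` gains at most `#T * d`. -/
theorem submodular_union_sub_le_card_mul {ι : Type*} [DecidableEq ι] {f : Finset ι → ℝ}
    (hsub : ∀ A B : Finset ι, A ⊆ B → ∀ x ∉ B,
      f (insert x A) - f A ≥ f (insert x B) - f B)
    {A : Finset ι} {d : ℝ} (hd : 0 ≤ d) (hA : ∀ y ∉ A, f (insert y A) - f A ≤ d)
    (T : Finset ι) : f (A ∪ T) - f A ≤ T.card * d := by
  induction T using Finset.induction_on with
  | empty => simp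
  | insert y T hy ih =>
    rw [Finset.card_insert_of_notMem hy, Finset.union_insert]
    push_cast
    by_cases h : y ∈ A ∪ T
    · rw [Finset.insert_eq_of_mem h]
      linarith
    · have h₁ := hsub A (A ∪ T) Finset.subset_union_left y h
      have h₂ := hA y fun hyA => h (Finset.mem_union_left T hyA)
      linarith

/-- **Greedy guarantee for monotone submodular maximization (finite-k form).**
If `f : Finset ι → ℝ` is normalized (`f ∅ = 0`), monotone and submodular, and
`G 0 = ∅, G 1, …, G k` is the greedy sequence (at each step inserting an element
not yet chosen that maximizes the resulting value of `f`), then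
`f (G k) ≥ (1 - (1 - 1/k)^k) · f S` for every subset `S` of cardinality `k`. -/
theorem greedy_submodular_guarantee_finite
    {ι : Type*} [Fintype ι] [DecidableEq ι] (f : Finset ι → ℝ)
    (hf0 : f ∅ = 0)
    (hmono : ∀ A B : Finset ι, A ⊆ B → f A ≤ f B)
    (hsub : ∀ A B : Finset ι, A ⊆ B → ∀ x ∉ B,
      f (insert x A) - f A ≥ f (insert x B) - f B)
    (k : ℕ) (hk : 1 ≤ k)
    (G : ℕ → Finset ι) (hG0 : G 0 = ∅)
    (hgreedy : ∀ i < k, ∃ x ∉ G i,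
      G (i + 1) = insert x (G i) ∧ ∀ y ∉ G i, f (insert y (G i)) ≤ f (insert x (G i)))
    (S : Finset ι) (hS : S.card = k) :
    f (G k) ≥ (1 - (1 - 1 / (k : ℝ)) ^ k) * f S := by
  have hk0 : (0 : ℝ) < k := by exact_mod_cast hk
  have hk1 : (1 : ℝ) / k ≤ 1 := by
    rw [div_le_one hk0]
    exact_mod_cast hk
  have step : ∀ i < k, f S - f (G (i + 1)) ≤ (1 - 1 / (k : ℝ)) * (f S - f (G i)) := by
    intro i hi
    obtain ⟨x, -, hGx, hmax⟩ := hgreedy i hi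
    rw [← hGx] at hmax
    have hgain : 0 ≤ f (G (i + 1)) - f (G i) :=
      sub_nonneg.2 (hmono _ _ (hGx ▸ Finset.subset_insert x (G i)))
    have hunion := submodular_union_sub_le_card_mul hsub hgain
      (fun y hy => sub_le_sub_right (hmax y hy) _) S
    rw [hS] at hunion
    have hle := hmono S (G i ∪ S) Finset.subset_union_right
    have hdiv : (f S - f (G i)) / k ≤ f (G (i + 1)) - f (G i) := by
      rw [div_le_iff₀' hk0]
      linarith
    calc f S - f (G (i + 1)) ≤ f S - f (G i) - (f S - f (G i)) / k := by linarith
      _ = (1 - 1 / (k : ℝ)) * (f S - f (G i)) := by ring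
  have gap : ∀ i ≤ k, f S - f (G i) ≤ (1 - 1 / (k : ℝ)) ^ i * f S := by
    intro i
    induction i with
    | zero => simp [hG0, hf0]
    | succ i ih =>
      intro hi
      calc f S - f (G (i + 1)) ≤ (1 - 1 / (k : ℝ)) * (f S - f (G i)) := step i hi
        _ ≤ (1 - 1 / (k : ℝ)) * ((1 - 1 / (k : ℝ)) ^ i * f S) :=
          mul_le_mul_of_nonneg_left (ih (Nat.le_of_succ_le hi)) (sub_nonneg.2 hk1)
        _ = (1 - 1 / (k : ℝ)) ^ (i + 1) * f S := by ring
  linarith [gap k le_rfl]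
end

section
/- Let ι be a finite type and let f : Finset ι → ℝ be a set function with f(∅) = 0 that is monotone (for all A ⊆ B, f(A) ≤ f(B)) and submodular (for all A ⊆ B and x ∉ B, f(A ∪ {x}) − f(A) ≥ f(B ∪ {x}) − f(B)). Let k ≥ 1 and let G_k be the set produced after k steps of the greedy algorithm (at each step adding an element maximizing the marginal gain of f). Then f(G_k) ≥ (1 − 1/e) · max { f(S) : S ⊆ ι, |S| = k }, where e is Euler's number. -/
/-- The joint gain of a set over `A`, for a monotone submodular function, is at most the sum of the
marginal gains of its elements. -/
theorem submodular_union_le_add_sum_marginal {ι : Type*} [DecidableEq ι] (f : Finset ι → ℝ)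
    (hmono : ∀ A B : Finset ι, A ⊆ B → f A ≤ f B)
    (hsub : ∀ A B : Finset ι, A ⊆ B → ∀ x ∉ B,
      f (insert x A) - f A ≥ f (insert x B) - f B)
    (A T : Finset ι) : f (A ∪ T) ≤ f A + ∑ y ∈ T, (f (insert y A) - f A) := by
  induction T using Finset.induction_on with
  | empty => simp
  | insert y T hy ih =>
    rw [Finset.sum_insert hy, Finset.union_insert]
    by_cases h : y ∈ A ∪ T
    · rw [Finset.insert_eq_of_mem h]
      linarith [hmono A (insert y A) (Finset.subset_insert y A)]
    · linarith [hsub A (A ∪ T) Finset.subset_union_left y h]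


/-- **Greedy guarantee for monotone submodular maximization ((1 - 1/e) form).**
If `f : Finset ι → ℝ` is normalized (`f ∅ = 0`), monotone and submodular, and
`G k` is the set produced after `k` steps of the greedy algorithm (at each step
inserting an element not yet chosen that maximizes the resulting value of `f`),
then `f (G k) ≥ (1 - 1/e) · f S` for every subset `S` of cardinality `k`. -/
theorem greedy_submodular_guarantee_one_sub_inv_exp
    {ι : Type*} [Fintype ι] [DecidableEq ι] (f : Finset ι → ℝ)
    (hf0 : f ∅ = 0)
    (hmono : ∀ A B : Finset ι, A ⊆ B → f A ≤ f B)
    (hsub : ∀ A B : Finset ι, A ⊆ B → ∀ x ∉ B,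
      f (insert x A) - f A ≥ f (insert x B) - f B)
    (k : ℕ) (hk : 1 ≤ k)
    (G : ℕ → Finset ι) (hG0 : G 0 = ∅)
    (hgreedy : ∀ i < k, ∃ x ∉ G i,
      G (i + 1) = insert x (G i) ∧ ∀ y ∉ G i, f (insert y (G i)) ≤ f (insert x (G i)))
    (S : Finset ι) (hS : S.card = k) :
    f (G k) ≥ (1 - 1 / Real.exp 1) * f S := by
  have hk0 : (0 : ℝ) < k := by exact_mod_cast hk
  have hk1 : (1 : ℝ) ≤ k := by exact_mod_cast hk
  have gain : ∀ i < k, f S - f (G i) ≤ k * (f (G (i + 1)) - f (G i)) := by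
    intro i hi
    obtain ⟨x, -, hx, hmax⟩ := hgreedy i hi
    have hsum : ∑ y ∈ S, (f (insert y (G i)) - f (G i)) ≤ S.card • (f (G (i + 1)) - f (G i)) := by
      refine Finset.sum_le_card_nsmul _ _ _ fun y _ => ?_
      rw [hx]
      by_cases hy : y ∈ G i
      · rw [Finset.insert_eq_of_mem hy]
        linarith [hmono (G i) (insert x (G i)) (Finset.subset_insert x _)]
      · linarith [hmax y hy]
    rw [hS, nsmul_eq_mul] at hsum
    linarith [submodular_union_le_add_sum_marginal f hmono hsub (G i) S,
      hmono S (G i ∪ S) Finset.subset_union_right]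
  have gap : ∀ i ≤ k, f S - f (G i) ≤ (1 - 1 / (k : ℝ)) ^ i * f S := by
    intro i
    induction i with
    | zero => simp [hG0, hf0]
    | succ i ih =>
      intro hi
      have hfac : 0 ≤ 1 - 1 / (k : ℝ) := sub_nonneg.2 ((div_le_one hk0).2 hk1)
      calc f S - f (G (i + 1)) ≤ (1 - 1 / (k : ℝ)) * (f S - f (G i)) := by
            have h := (div_le_iff₀' hk0).2 (gain i hi)
            linear_combination h
        _ ≤ (1 - 1 / (k : ℝ)) * ((1 - 1 / (k : ℝ)) ^ i * f S) :=
            mul_le_mul_of_nonneg_left (ih (by omega)) hfac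
        _ = (1 - 1 / (k : ℝ)) ^ (i + 1) * f S := by ring
  have hfS : 0 ≤ f S := hf0 ▸ hmono ∅ S (Finset.empty_subset S)
  have hexp : (1 - 1 / (k : ℝ)) ^ k ≤ 1 / Real.exp 1 := by
    rw [one_div (Real.exp 1), ← Real.exp_neg]
    exact Real.one_sub_div_pow_le_exp_neg hk1
  linarith [gap k le_rfl, mul_le_mul_of_nonneg_right hexp hfS]
end
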